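/- arXiv:1703.01677 — 3 statements merged into one kernel-verified Lean document; each statement's English description precedes it below -/
import Mathlib

section
/- A natural number a satisfies both 2a² = x³ and 2a³ = y² for some natural numbers x and y if and only if a = 2n⁶ for some natural number n; in that case one may take x = 2n⁴ and y = 4n⁹. -/
/-- If a square of naturals is a cube, its base is a cube. -/
theorem Nat.exists_eq_cube_of_sq_eq_cube {b u : ℕ} (h : b ^ 2 = u ^ 3) : ∃ c, b = c ^ 3 := by
  rcases Nat.eq_zero_or_pos u with rfl | hu
  · exact ⟨0, by simpa using h⟩
  · obtain ⟨c, rfl⟩ : u ∣ b := (Nat.pow_dvd_pow_iff two_ne_zero).1 ⟨u, by rw [h]; ring⟩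
    have hc : c ^ 2 = u := Nat.eq_of_mul_eq_mul_left (pow_pos hu 2) (by linarith)
    exact ⟨c, by rw [← hc]; ring⟩

/-- If an odd power of a natural number is a square, so is the number itself. -/
theorem Nat.exists_eq_sq_of_odd_pow_eq_sq {c w k : ℕ} (h : c ^ (2 * k + 1) = w ^ 2) :
    ∃ n, c = n ^ 2 := by
  rcases Nat.eq_zero_or_pos c with rfl | hc
  · exact ⟨0, rfl⟩
  · obtain ⟨n, rfl⟩ : c ^ k ∣ w := (Nat.pow_dvd_pow_iff two_ne_zero).1 ⟨c, by rw [← h]; ring⟩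
    refine ⟨n, Nat.eq_of_mul_eq_mul_left (pow_pos (pow_pos hc k) 2) ?_⟩
    rw [← mul_pow, ← h]
    ring

/-- A natural number `a` satisfies `2a² = x³` and `2a³ = y²` for some naturals
`x`, `y` if and only if `a = 2n⁶` for some natural `n`; in that case one may
take `x = 2n⁴` and `y = 4n⁹`. -/
theorem bhaskara_twin_iff (a : ℕ) :
    (∃ x y : ℕ, 2 * a ^ 2 = x ^ 3 ∧ 2 * a ^ 3 = y ^ 2) ↔
    (∃ n : ℕ, a = 2 * n ^ 6 ∧
      2 * a ^ 2 = (2 * n ^ 4) ^ 3 ∧ 2 * a ^ 3 = (4 * n ^ 9) ^ 2) := by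
  constructor
  · rintro ⟨x, y, hx, hy⟩
    obtain ⟨u, rfl⟩ : 2 ∣ x := Nat.prime_two.dvd_of_dvd_pow ⟨a ^ 2, hx.symm⟩
    obtain ⟨b, rfl⟩ : 2 ∣ a := Nat.prime_two.dvd_of_dvd_pow (n := 2) ⟨2 * u ^ 3, by linarith⟩
    obtain ⟨w, rfl⟩ : 4 ∣ y := (Nat.pow_dvd_pow_iff two_ne_zero).1 ⟨b ^ 3, by rw [← hy]; ring⟩
    obtain ⟨c, rfl⟩ := Nat.exists_eq_cube_of_sq_eq_cube (b := b) (u := u) (by linarith)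
    obtain ⟨n, rfl⟩ := Nat.exists_eq_sq_of_odd_pow_eq_sq (c := c) (w := w) (k := 4)
      (by norm_num; linarith)
    exact ⟨n, by ring, by ring, by ring⟩
  · rintro ⟨n, -, hx, hy⟩
    exact ⟨_, _, hx, hy⟩
end

section
/- If u and k are coprime positive integers, then the greatest common divisor of u² + k² and u³ + k³ equals 2 if k − u is even (i.e. u and k are both odd) and equals 1 if k − u is odd. -/
theorem Nat.Coprime.gcd_sq_add_sq_cube_add_cube_dvd_two {u k : ℕ} (h : Nat.Coprime u k) :
    Nat.gcd (u ^ 2 + k ^ 2) (u ^ 3 + k ^ 3) ∣ 2 := by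
  set d := Nat.gcd (u ^ 2 + k ^ 2) (u ^ 3 + k ^ 3)
  have h2 : d ∣ u ^ 2 + k ^ 2 := Nat.gcd_dvd_left _ _
  have h3 : d ∣ u ^ 3 + k ^ 3 := Nat.gcd_dvd_right _ _
  have hsq : Nat.Coprime (u ^ 2 + k ^ 2) (u * k) := by
    refine Nat.Coprime.mul_right ?_ ?_
    · rw [pow_two u, Nat.coprime_mul_left_add_left]
      exact h.symm.pow_left 2
    · rw [pow_two k, Nat.coprime_add_mul_left_left]
      exact h.pow_left 2
  have hd : Nat.Coprime d (u * k) := hsq.coprime_dvd_left h2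
  have hsum : d ∣ u + k := by
    refine hd.dvd_of_dvd_mul_left ((Nat.dvd_add_right h3).mp ?_)
    have key : u ^ 3 + k ^ 3 + u * k * (u + k) = (u + k) * (u ^ 2 + k ^ 2) := by ring
    exact key ▸ h2.mul_left (u + k)
  refine hd.dvd_of_dvd_mul_left ((Nat.dvd_add_right h2).mp ?_)
  have key : u ^ 2 + k ^ 2 + u * k * 2 = (u + k) * (u + k) := by ring
  exact key ▸ hsum.mul_left (u + k)

/-- For coprime positive integers `u` and `k`, the gcd of `u² + k²` and
`u³ + k³` equals `2` if `k − u` is even and `1` if `k − u` is odd. -/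
theorem gcd_sq_add_sq_cube_add_cube (u k : ℕ) (hu : 0 < u) (hk : 0 < k)
    (h : Nat.gcd u k = 1) :
    (Even ((k : ℤ) - (u : ℤ)) →
      Nat.gcd (u ^ 2 + k ^ 2) (u ^ 3 + k ^ 3) = 2) ∧
    (¬ Even ((k : ℤ) - (u : ℤ)) →
      Nat.gcd (u ^ 2 + k ^ 2) (u ^ 3 + k ^ 3) = 1) := by
  have hdvd := Nat.Coprime.gcd_sq_add_sq_cube_add_cube_dvd_two h
  rw [Int.even_sub, Int.even_coe_nat, Int.even_coe_nat]
  refine ⟨fun hpar => Nat.dvd_antisymm hdvd (Nat.dvd_gcd ?_ ?_), fun hpar => ?_⟩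
  · rw [← even_iff_two_dvd]
    simp [Nat.even_add, Nat.even_pow, hpar]
  · rw [← even_iff_two_dvd]
    simp [Nat.even_add, Nat.even_pow, hpar]
  · refine ((Nat.dvd_prime Nat.prime_two).mp hdvd).resolve_right fun h2 => hpar ?_
    have heven : Even (u ^ 2 + k ^ 2) :=
      even_iff_two_dvd.mpr (h2.symm.dvd.trans (Nat.gcd_dvd_left _ _))
    simpa [Nat.even_add, Nat.even_pow, iff_comm] using heven
end

section
/- There are no solutions to (4k + 1) + p² = x³ with p a prime, k and x natural numbers, and 4k + 1 < p². -/
/-- There are no solutions to `(4k + 1) + p² = x³` with `p` prime, `k`, `x`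
natural numbers and `4k + 1 < p²`. -/
theorem no_sol_four_k_add_one (k x p : ℕ) (hp : p.Prime)
    (hlt : 4 * k + 1 < p ^ 2) : 4 * k + 1 + p ^ 2 ≠ x ^ 3 := by
  intro h
  rcases hp.eq_two_or_odd' with rfl | ⟨m, rfl⟩
  · obtain rfl : k = 0 := by omega
    have hx : x < 2 := by
      by_contra! hx
      have := Nat.pow_le_pow_left hx 3
      omega
    interval_cases x <;> omega
  · have hmod : x ^ 3 % 4 = 2 := by
      rw [← h, show 4 * k + 1 + (2 * m + 1) ^ 2 = 2 + 4 * (k + m ^ 2 + m) by ring]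
      omega
    have hx : x % 4 < 4 := Nat.mod_lt _ (by norm_num)
    rw [Nat.pow_mod] at hmod
    interval_cases x % 4 <;> omega
end
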